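/- arXiv:1406.5295 — 2 statements merged into one kernel-verified Lean document; each statement's English description precedes it below -/
import Mathlib

section
/- Suppose every column of X is nonzero and β_LS ∈ ℝ^p satisfies Xᵀ(y − Xβ_LS) = 0. Fix β_0 ∈ ℝ^p and t ≥ 0. For an index sequence ω ∈ {1,…,p}^t, let β_t(ω) be the result of applying coordinate descent updates successively on coordinates ω_1, …, ω_t starting from β_0, and let P(ω) = ∏_{k=1}^t ‖X_{ω_k}‖²/‖X‖_F². Then Σ_ω P(ω) ‖Xβ_t(ω) − Xβ_LS‖² ≤ (1 − λ_min(XᵀX)/‖X‖_F²)^t ‖Xβ_0 − Xβ_LS‖²; i.e., Randomized Coordinate Descent converges linearly in expectation to the least-squares solution in the Σ-seminorm, even for an inconsistent system. -/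
open Matrix BigOperators

/-- The coordinate descent update of `β` on coordinate `j`:
`RCD_j(β) = β + (X_jᵀ(y − Xβ)/‖X_j‖²) e_j`. -/
noncomputable def RCD {n p : ℕ} (X : Matrix (Fin n) (Fin p) ℝ) (y : Fin n → ℝ)
    (j : Fin p) (β : Fin p → ℝ) : Fin p → ℝ :=
  β + ((∑ i, X i j * (y i - X.mulVec β i)) / ∑ i, (X i j) ^ 2) • (Pi.single j 1 : Fin p → ℝ)

/-- The result of applying coordinate descent updates successively on coordinates
`ω 1, …, ω t`, starting from `β0`. -/
noncomputable def iterRCD {n p : ℕ} (X : Matrix (Fin n) (Fin p) ℝ) (y : Fin n → ℝ)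
    (β0 : Fin p → ℝ) (t : ℕ) (ω : Fin t → Fin p) : Fin p → ℝ :=
  (List.ofFn ω).foldl (fun β j => RCD X y j β) β0

theorem rayleigh_aux {p : ℕ} (A : Matrix (Fin p) (Fin p) ℝ) (hA : A.IsHermitian) (c : ℝ)
    (hc : ∀ k, c ≤ hA.eigenvalues k) (d : Fin p → ℝ) : c * (d ⬝ᵥ d) ≤ d ⬝ᵥ A *ᵥ d := by
  set U : Matrix (Fin p) (Fin p) ℝ := (hA.eigenvectorUnitary : Matrix (Fin p) (Fin p) ℝ) with hU
  have hspec : A = U * diagonal hA.eigenvalues * Uᵀ := by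
    have h := hA.spectral_theorem
    rw [Unitary.conjStarAlgAut_apply] at h
    simpa [Matrix.star_eq_conjTranspose, Matrix.conjTranspose_eq_transpose_of_trivial,
      Function.comp_def] using h
  have hUU : U * Uᵀ = 1 := by
    have h := Unitary.coe_mul_star_self hA.eigenvectorUnitary
    simpa [Matrix.star_eq_conjTranspose, Matrix.conjTranspose_eq_transpose_of_trivial] using h
  have h1 : d ⬝ᵥ d = (Uᵀ *ᵥ d) ⬝ᵥ (Uᵀ *ᵥ d) := by
    rw [Matrix.dotProduct_mulVec, Matrix.vecMul_transpose, Matrix.mulVec_mulVec, hUU,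
      Matrix.one_mulVec]
  have h2 : d ⬝ᵥ A *ᵥ d = (Uᵀ *ᵥ d) ⬝ᵥ (diagonal hA.eigenvalues *ᵥ (Uᵀ *ᵥ d)) := by
    conv_lhs => rw [hspec]
    rw [← Matrix.mulVec_mulVec, ← Matrix.mulVec_mulVec, Matrix.dotProduct_mulVec,
      ← Matrix.mulVec_transpose]
  rw [h1, h2]
  simp only [dotProduct, Matrix.mulVec_diagonal, Finset.mul_sum]
  apply Finset.sum_le_sum
  intro k _
  nlinarith [hc k, mul_nonneg (sub_nonneg.2 (hc k)) (mul_self_nonneg ((Uᵀ *ᵥ d) k))]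

theorem gram_aux {n p : ℕ} (X : Matrix (Fin n) (Fin p) ℝ) (d : Fin p → ℝ) :
    d ⬝ᵥ (Xᵀ * X) *ᵥ d = ∑ i, (X.mulVec d i) ^ 2 := by
  rw [← Matrix.mulVec_mulVec, Matrix.dotProduct_mulVec, Matrix.vecMul_transpose]
  simp [dotProduct, sq]

theorem gap_aux {n p : ℕ} (X : Matrix (Fin n) (Fin p) ℝ) (c : ℝ) (hc0 : 0 ≤ c)
    (hc : ∀ d : Fin p → ℝ, c * (d ⬝ᵥ d) ≤ ∑ i, (X.mulVec d i) ^ 2) (d : Fin p → ℝ) :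
    c * ∑ i, (X.mulVec d i) ^ 2 ≤ ∑ j, (∑ i, X i j * X.mulVec d i) ^ 2 := by
  set S := ∑ i, (X.mulVec d i) ^ 2 with hS
  set T := ∑ j, (∑ i, X i j * X.mulVec d i) ^ 2 with hT
  have hT0 : 0 ≤ T := Finset.sum_nonneg fun j _ => sq_nonneg _
  have hS0 : 0 ≤ S := Finset.sum_nonneg fun j _ => sq_nonneg _
  have hSd : S = ∑ j, d j * (∑ i, X i j * X.mulVec d i) := by
    rw [hS, ← gram_aux, ← Matrix.mulVec_mulVec]
    rfl
  have hCS : S ^ 2 ≤ (d ⬝ᵥ d) * T := by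
    rw [hSd]
    refine (Finset.sum_mul_sq_le_sq_mul_sq _ _ _).trans (le_of_eq ?_)
    simp [dotProduct, sq, hT]
  rcases hS0.eq_or_lt with h | h
  · rw [← h]; simpa using hT0
  · have h1 := mul_le_mul_of_nonneg_left hCS hc0
    have h2 := mul_le_mul_of_nonneg_right (hc d) hT0
    have h3 : S * (c * S) ≤ S * T := by nlinarith
    exact le_of_mul_le_mul_left h3 h

theorem step_aux {n p : ℕ} (X : Matrix (Fin n) (Fin p) ℝ) (y : Fin n → ℝ)
    (βLS : Fin p → ℝ) (hLS : Xᵀ.mulVec (y - X.mulVec βLS) = 0) (β : Fin p → ℝ) (j : Fin p)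
    (hj : 0 < ∑ i, (X i j) ^ 2) :
    (∑ i, (X i j) ^ 2) * ∑ i, (X.mulVec (RCD X y j β) i - X.mulVec βLS i) ^ 2 =
      (∑ i, (X i j) ^ 2) * ∑ i, (X.mulVec β i - X.mulVec βLS i) ^ 2 -
        (∑ i, X i j * X.mulVec (β - βLS) i) ^ 2 := by
  have h0 : ∑ i, X i j * (y i - X.mulVec βLS i) = 0 := congrFun hLS j
  have hg : ∑ i, X i j * (y i - X.mulVec β i) = - ∑ i, X i j * X.mulVec (β - βLS) i := by
    rw [← sub_zero (∑ i, X i j * (y i - X.mulVec β i)), ← h0, ← Finset.sum_sub_distrib,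
      ← Finset.sum_neg_distrib]
    refine Finset.sum_congr rfl fun i _ => ?_
    rw [Matrix.mulVec_sub, Pi.sub_apply]; ring
  set N := ∑ i, (X i j) ^ 2 with hN
  set g := ∑ i, X i j * X.mulVec (β - βLS) i with hgdef
  have hstep : ∀ i, X.mulVec (RCD X y j β) i = X.mulVec β i + (-g / N) * X i j := by
    intro i
    simp only [RCD, hg, ← hN, Matrix.mulVec_add, Matrix.mulVec_smul, Pi.add_apply, Pi.smul_apply,
      smul_eq_mul, Matrix.mulVec_single_one, Matrix.col_apply]
  have hexp : ∑ i, (X.mulVec (RCD X y j β) i - X.mulVec βLS i) ^ 2 =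
      ∑ i, (X.mulVec β i - X.mulVec βLS i) ^ 2 + 2 * (-g / N) * g + (-g / N) ^ 2 * N := by
    rw [hN, hgdef, Finset.mul_sum, Finset.mul_sum, ← hN, ← hgdef, ← Finset.sum_add_distrib,
      ← Finset.sum_add_distrib]
    refine Finset.sum_congr rfl fun i _ => ?_
    rw [hstep, Matrix.mulVec_sub, Pi.sub_apply]; ring
  rw [hexp]
  field_simp
  ring

/-- If `β_LS` satisfies the normal equations `Xᵀ(y − Xβ_LS) = 0` and all
columns of `X` are nonzero, Randomized Coordinate Descent converges linearly in
expectation to the least-squares solution in fitted-value space: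
`E‖Xβ_t − Xβ_LS‖² ≤ (1 − λ_min(XᵀX)/‖X‖_F²)^t ‖Xβ_0 − Xβ_LS‖²`, where the expectation is
over index sequences `ω` with probability `P(ω) = ∏_k ‖X_{ω_k}‖²/‖X‖_F²`. -/
theorem randomized_cd_linear_convergence_fitted {n p : ℕ}
    (X : Matrix (Fin n) (Fin p) ℝ) (y : Fin n → ℝ)
    (hcols : ∀ j, (fun i => X i j) ≠ 0)
    (βLS : Fin p → ℝ) (hLS : Xᵀ.mulVec (y - X.mulVec βLS) = 0)
    (hA : (Xᵀ * X).IsHermitian) (β0 : Fin p → ℝ) (t : ℕ) :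
    ∑ ω : Fin t → Fin p,
        (∏ k, (∑ i, (X i (ω k)) ^ 2) / ∑ j, ∑ i, (X i j) ^ 2) *
          ∑ i, (X.mulVec (iterRCD X y β0 t ω) i - X.mulVec βLS i) ^ 2
      ≤ (1 - (⨅ k, hA.eigenvalues k) / ∑ j, ∑ i, (X i j) ^ 2) ^ t *
        ∑ i, (X.mulVec β0 i - X.mulVec βLS i) ^ 2 := by
  set F := ∑ j, ∑ i, (X i j) ^ 2 with hF
  set c := ⨅ k, hA.eigenvalues k with hc
  have hN : ∀ j, 0 < ∑ i, (X i j) ^ 2 := by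
    intro j
    obtain ⟨i, hi⟩ := Function.ne_iff.1 (hcols j)
    exact Finset.sum_pos' (fun i _ => sq_nonneg _) ⟨i, Finset.mem_univ _, by have : X i j ≠ 0 := hi; positivity⟩
  have hF0 : 0 ≤ F := Finset.sum_nonneg fun j _ => (hN j).le
  have hck : ∀ k, c ≤ hA.eigenvalues k := fun k => ciInf_le (Set.finite_range _).bddBelow k
  have hc0 : 0 ≤ c := Real.iInf_nonneg fun k => by
    have := Matrix.eigenvalues_conjTranspose_mul_self_nonneg X k
    exact this
  have hray : ∀ d : Fin p → ℝ, c * (d ⬝ᵥ d) ≤ ∑ i, (X.mulVec d i) ^ 2 := fun d =>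
    (rayleigh_aux _ hA c hck d).trans (le_of_eq (gram_aux X d))
  have hgap := gap_aux X c hc0 hray
  have hFj : ∀ j, ∑ i, (X i j) ^ 2 ≤ F := fun j =>
    Finset.single_le_sum (f := fun j => ∑ i, (X i j) ^ 2) (fun j _ => (hN j).le)
      (Finset.mem_univ j)
  have hq : 0 ≤ 1 - c / F := by
    rw [sub_nonneg]
    rcases isEmpty_or_nonempty (Fin p) with h | ⟨⟨j⟩⟩
    · simp [hF]
    · refine div_le_one_of_le₀ (le_trans ?_ (hFj j)) hF0
      simpa using hray (Pi.single j 1)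
  have hone : ∀ β : Fin p → ℝ,
      ∑ j, ((∑ i, (X i j) ^ 2) / F) * ∑ i, (X.mulVec (RCD X y j β) i - X.mulVec βLS i) ^ 2 ≤
        (1 - c / F) * ∑ i, (X.mulVec β i - X.mulVec βLS i) ^ 2 := by
    intro β
    rcases isEmpty_or_nonempty (Fin p) with h | ⟨⟨j0⟩⟩
    · simpa using mul_nonneg hq (Finset.sum_nonneg fun i _ => sq_nonneg _)
    have hFpos : 0 < F := (hN j0).trans_le (hFj j0)
    have hg := hgap (β - βLS)
    have e1 : ∑ i, (X.mulVec (β - βLS) i) ^ 2 = ∑ i, (X.mulVec β i - X.mulVec βLS i) ^ 2 := by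
      simp only [Matrix.mulVec_sub, Pi.sub_apply]
    rw [e1] at hg
    simp only [div_mul_eq_mul_div]
    rw [← Finset.sum_div, Finset.sum_congr rfl fun j _ => step_aux X y βLS hLS β j (hN j),
      Finset.sum_sub_distrib, ← Finset.sum_mul, div_le_iff₀ hFpos, ← hF]
    have e2 : (1 - c / F) * (∑ i, (X.mulVec β i - X.mulVec βLS i) ^ 2) * F =
        F * (∑ i, (X.mulVec β i - X.mulVec βLS i) ^ 2) -
          c * ∑ i, (X.mulVec β i - X.mulVec βLS i) ^ 2 := by
      field_simp
    rw [e2]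
    linarith
  induction t generalizing β0 with
  | zero => simp [iterRCD]
  | succ t ih =>
    rw [← (Fin.consEquiv fun _ : Fin (t + 1) => Fin p).sum_comp, Fintype.sum_prod_type]
    have hit : ∀ (j : Fin p) (ω : Fin t → Fin p),
        iterRCD X y β0 (t + 1) (Fin.consEquiv (fun _ : Fin (t + 1) => Fin p) (j, ω)) = iterRCD X y (RCD X y j β0) t ω := by
      intro j ω
      simp [iterRCD, List.ofFn_succ, Fin.consEquiv]
    simp only [hit]
    simp only [Fin.consEquiv_apply, Fin.prod_univ_succ, Fin.cons_zero, Fin.cons_succ,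
      mul_assoc, ← Finset.mul_sum]
    calc _ ≤ ∑ j, ((∑ i, (X i j) ^ 2) / F) * ((1 - c / F) ^ t *
              ∑ i, (X.mulVec (RCD X y j β0) i - X.mulVec βLS i) ^ 2) := by
            refine Finset.sum_le_sum fun j _ => ?_
            exact mul_le_mul_of_nonneg_left (ih _) (div_nonneg (hN j).le hF0)
      _ = (1 - c / F) ^ t * ∑ j, ((∑ i, (X i j) ^ 2) / F) *
              ∑ i, (X.mulVec (RCD X y j β0) i - X.mulVec βLS i) ^ 2 := by
            rw [Finset.mul_sum]
            exact Finset.sum_congr rfl fun j _ => by ring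
      _ ≤ (1 - c / F) ^ t * ((1 - c / F) * ∑ i, (X.mulVec β0 i - X.mulVec βLS i) ^ 2) :=
            mul_le_mul_of_nonneg_left (hone β0) (pow_nonneg hq t)
      _ = _ := by rw [pow_succ]; ring
end

section
/- Let A be a real symmetric positive semidefinite m×m matrix with strictly positive diagonal entries, b ∈ ℝ^m, and x* with Ax* = b. Fix x_0 ∈ ℝ^m and t ≥ 0. For an index sequence ω ∈ {1,…,m}^t, let x_t(ω) be the result of applying coordinate descent updates CD_{ω_1}, …, CD_{ω_t} starting from x_0, where CD_i(x) = x + ((b_i − A_i·x)/A_ii) e_i, and let P(ω) = ∏_{k=1}^t A_{ω_k ω_k}/Tr(A). Then Σ_ω P(ω) ‖x_t(ω) − x*‖²_A ≤ (1 − λ_min(A)/Tr(A))^t ‖x_0 − x*‖²_A. -/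
open Matrix BigOperators

/-- The coordinate descent update for the system `Ax = b` on coordinate `i`:
`CD_i(x) = x + ((b_i − A_i·x)/A_ii) e_i`. -/
noncomputable def CD {m : ℕ} (A : Matrix (Fin m) (Fin m) ℝ) (b : Fin m → ℝ)
    (i : Fin m) (x : Fin m → ℝ) : Fin m → ℝ :=
  x + ((b i - ∑ j, A i j * x j) / A i i) • (Pi.single i 1 : Fin m → ℝ)

/-- The result of applying coordinate descent updates `CD_{ω 1}, …, CD_{ω t}`,
starting from `x0`. -/
noncomputable def iterCD {m : ℕ} (A : Matrix (Fin m) (Fin m) ℝ) (b : Fin m → ℝ)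
    (x0 : Fin m → ℝ) (t : ℕ) (ω : Fin t → Fin m) : Fin m → ℝ :=
  (List.ofFn ω).foldl (fun x i => CD A b i x) x0

lemma rcd_parseval {m : ℕ} {A : Matrix (Fin m) (Fin m) ℝ} (hA : A.IsHermitian)
    (u w : Fin m → ℝ) :
    u ⬝ᵥ w = ∑ i, ((hA.eigenvectorBasis i : Fin m → ℝ) ⬝ᵥ u) *
      ((hA.eigenvectorBasis i : Fin m → ℝ) ⬝ᵥ w) := by
  have h := hA.eigenvectorBasis.sum_inner_mul_inner (WithLp.toLp 2 u) (WithLp.toLp 2 w)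
  simp only [EuclideanSpace.inner_eq_star_dotProduct, star_trivial] at h
  rw [dotProduct_comm u w, ← h]
  refine Finset.sum_congr rfl fun i _ => ?_
  rw [dotProduct_comm w]

lemma rcd_eig {m : ℕ} {A : Matrix (Fin m) (Fin m) ℝ} (hA : A.IsHermitian)
    (d : Fin m → ℝ) (i : Fin m) :
    (hA.eigenvectorBasis i : Fin m → ℝ) ⬝ᵥ A.mulVec d =
      hA.eigenvalues i * ((hA.eigenvectorBasis i : Fin m → ℝ) ⬝ᵥ d) := by
  have hT : Aᵀ = A := isHermitian_iff_isSymm.mp hA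
  rw [dotProduct_mulVec, ← mulVec_transpose, hT, hA.mulVec_eigenvectorBasis, smul_dotProduct,
    smul_eq_mul]

lemma rcd_spec {m : ℕ} {A : Matrix (Fin m) (Fin m) ℝ} (hA : A.PosSemidef) (d : Fin m → ℝ) :
    (⨅ i, hA.isHermitian.eigenvalues i) * (d ⬝ᵥ A.mulVec d) ≤ A.mulVec d ⬝ᵥ A.mulVec d := by
  rw [rcd_parseval hA.isHermitian d, rcd_parseval hA.isHermitian (A.mulVec d), Finset.mul_sum]
  refine Finset.sum_le_sum fun i _ => ?_
  rw [rcd_eig]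
  set c := (hA.isHermitian.eigenvectorBasis i : Fin m → ℝ) ⬝ᵥ d
  have h0 := hA.eigenvalues_nonneg i
  have h1 : (⨅ i, hA.isHermitian.eigenvalues i) ≤ hA.isHermitian.eigenvalues i :=
    ciInf_le (Set.finite_range _).bddBelow i
  have := mul_le_mul_of_nonneg_right h1 (mul_nonneg h0 (mul_self_nonneg c))
  linarith

lemma rcd_min_le {m : ℕ} {A : Matrix (Fin m) (Fin m) ℝ} (hA : A.PosSemidef) (i : Fin m) :
    (⨅ i, hA.isHermitian.eigenvalues i) ≤ A.trace := by
  have h1 : (⨅ i, hA.isHermitian.eigenvalues i) ≤ hA.isHermitian.eigenvalues i :=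
    ciInf_le (Set.finite_range _).bddBelow i
  refine h1.trans ?_
  have := hA.isHermitian.trace_eq_sum_eigenvalues
  simp only [RCLike.ofReal_real_eq_id, id] at this
  rw [this]
  exact Finset.single_le_sum (fun j _ => hA.eigenvalues_nonneg j) (Finset.mem_univ i)

lemma rcd_step {m : ℕ} {A : Matrix (Fin m) (Fin m) ℝ} (hA : A.PosSemidef)
    (hdiag : ∀ i, 0 < A i i) (xstar x : Fin m → ℝ) (i : Fin m) :
    A i i * ((CD A (A.mulVec xstar) i x - xstar) ⬝ᵥ
      A.mulVec (CD A (A.mulVec xstar) i x - xstar)) =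
    A i i * ((x - xstar) ⬝ᵥ A.mulVec (x - xstar)) - (A.mulVec (x - xstar) i) ^ 2 := by
  have hT : Aᵀ = A := isHermitian_iff_isSymm.mp hA.isHermitian
  set d := x - xstar with hd
  have h1 : CD A (A.mulVec xstar) i x - xstar
      = d + (-(A.mulVec d i) / A i i) • (Pi.single i 1 : Fin m → ℝ) := by
    have : A.mulVec xstar i - ∑ j, A i j * x j = -(A.mulVec d i) := by
      rw [hd, mulVec_sub, Pi.sub_apply]
      simp only [mulVec, dotProduct]
      ring
    rw [CD, this, hd]
    abel
  have h2 : d ⬝ᵥ A.mulVec (Pi.single i 1) = A.mulVec d i := by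
    rw [dotProduct_mulVec, ← mulVec_transpose, hT]
    simp
  have hne := (hdiag i).ne'
  rw [h1]
  generalize hs : -(A.mulVec d i) / A i i = s
  have hs' : A.mulVec d i = - (s * A i i) := by rw [← hs]; field_simp
  simp only [mulVec_add, mulVec_smul, dotProduct_add, add_dotProduct, smul_dotProduct,
    dotProduct_smul, h2, smul_eq_mul, single_dotProduct, one_mul]
  rw [show A.mulVec (Pi.single i 1) i = A i i by simp, hs']
  ring

lemma rcd_one {m : ℕ} {A : Matrix (Fin m) (Fin m) ℝ} (hA : A.PosSemidef)
    (hdiag : ∀ i, 0 < A i i) (xstar x : Fin m → ℝ) (hT : 0 < A.trace) :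
    ∑ i, A i i / A.trace * ((CD A (A.mulVec xstar) i x - xstar) ⬝ᵥ
      A.mulVec (CD A (A.mulVec xstar) i x - xstar)) ≤
    (1 - (⨅ i, hA.isHermitian.eigenvalues i) / A.trace) *
      ((x - xstar) ⬝ᵥ A.mulVec (x - xstar)) := by
  have hs := rcd_spec hA (x - xstar)
  simp only [div_mul_eq_mul_div, rcd_step hA hdiag]
  rw [← Finset.sum_div, Finset.sum_sub_distrib, ← Finset.sum_mul, div_le_iff₀ hT]
  have e1 : ∑ i, A i i = A.trace := rfl
  have e2 : ∑ i, (A.mulVec (x - xstar) i) ^ 2 = A.mulVec (x - xstar) ⬝ᵥ A.mulVec (x - xstar) := by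
    simp [dotProduct, sq]
  rw [e1, e2]
  have : (1 - (⨅ i, hA.isHermitian.eigenvalues i) / A.trace) *
      ((x - xstar) ⬝ᵥ A.mulVec (x - xstar)) * A.trace = A.trace *
      ((x - xstar) ⬝ᵥ A.mulVec (x - xstar)) - (⨅ i, hA.isHermitian.eigenvalues i) *
      ((x - xstar) ⬝ᵥ A.mulVec (x - xstar)) := by
    field_simp
  linarith

/-- For a symmetric positive semidefinite `A` with positive diagonal and
`Ax* = b`, randomized coordinate descent converges linearly in expectation in the
`A`-seminorm: `E‖x_t − x*‖²_A ≤ (1 − λ_min(A)/Tr(A))^t ‖x_0 − x*‖²_A`, where the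
expectation is over index sequences `ω` with probability
`P(ω) = ∏_k A_{ω_k ω_k}/Tr(A)`. -/
theorem rcd_psd_linear_convergence {m : ℕ}
    (A : Matrix (Fin m) (Fin m) ℝ) (hA : A.PosSemidef)
    (hdiag : ∀ i, 0 < A i i)
    (b : Fin m → ℝ) (xstar : Fin m → ℝ) (hxstar : A.mulVec xstar = b)
    (x0 : Fin m → ℝ) (t : ℕ) :
    ∑ ω : Fin t → Fin m,
        (∏ k, A (ω k) (ω k) / A.trace) *
          ((iterCD A b x0 t ω - xstar) ⬝ᵥ A.mulVec (iterCD A b x0 t ω - xstar))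
      ≤ (1 - (⨅ i, hA.isHermitian.eigenvalues i) / A.trace) ^ t *
        ((x0 - xstar) ⬝ᵥ A.mulVec (x0 - xstar)) := by
  subst hxstar
  rcases Nat.eq_zero_or_pos m with hm | hm
  · subst hm
    simp [dotProduct]
  have hT : 0 < A.trace :=
    Finset.sum_pos (fun i _ => hdiag i) ⟨⟨0, hm⟩, Finset.mem_univ _⟩
  have hc : 0 ≤ 1 - (⨅ i, hA.isHermitian.eigenvalues i) / A.trace := by
    rw [sub_nonneg, div_le_one hT]
    exact rcd_min_le hA ⟨0, hm⟩
  induction t generalizing x0 with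
  | zero => simp [iterCD]
  | succ t ih =>
    rw [← (Fin.consEquiv (fun _ : Fin (t + 1) => Fin m)).sum_comp, Fintype.sum_prod_type]
    have key : ∀ (i : Fin m) (ω : Fin t → Fin m),
        iterCD A (A.mulVec xstar) x0 (t + 1) (Fin.cons i ω) =
          iterCD A (A.mulVec xstar) (CD A (A.mulVec xstar) i x0) t ω := by
      intro i ω
      simp [iterCD, List.ofFn_succ]
    simp only [Fin.consEquiv, Equiv.coe_fn_mk, key, Fin.prod_univ_succ, Fin.cons_zero,
      Fin.cons_succ, mul_assoc, ← Finset.mul_sum]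
    calc _ ≤ ∑ i, A i i / A.trace *
          ((1 - (⨅ i, hA.isHermitian.eigenvalues i) / A.trace) ^ t *
          ((CD A (A.mulVec xstar) i x0 - xstar) ⬝ᵥ
            A.mulVec (CD A (A.mulVec xstar) i x0 - xstar))) := by
          refine Finset.sum_le_sum fun i _ => ?_
          exact mul_le_mul_of_nonneg_left (ih _) (div_nonneg (hdiag i).le hT.le)
      _ = (1 - (⨅ i, hA.isHermitian.eigenvalues i) / A.trace) ^ t *
          ∑ i, A i i / A.trace * ((CD A (A.mulVec xstar) i x0 - xstar) ⬝ᵥ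
            A.mulVec (CD A (A.mulVec xstar) i x0 - xstar)) := by
          rw [Finset.mul_sum]
          refine Finset.sum_congr rfl fun i _ => ?_
          ring
      _ ≤ _ := by
          rw [pow_succ, mul_assoc]
          exact mul_le_mul_of_nonneg_left (rcd_one hA hdiag xstar x0 hT) (pow_nonneg hc t)
end
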